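/- For every integer j, the identity Σ_{k=|j|}^{∞} q^{k+1}·((q)_{k+j}·(q)_{k−j})⁻¹ = q·((q)_∞)⁻² · Σ_{k=0}^{∞} (−1)^k·q^{j(2k+1) + k(k+1)/2} holds in ℚ((q)), both families being summable. (Equivalently: the residue series r_j of the inverted Habiro series of the right-handed trefoil, whose inverted Habiro coefficients are a_{−k−1} = (−1)^{k+1} q^{−(k+1)(k−2)/2}, equals (−1)^j q^{j(j+1)/2+1}·((q)_∞)⁻²·Σ_{k≥0}(−1)^k q^{j(2k+1)+k(k+1)/2}.) -/

import Mathlib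

/-!
STATEMENT 15: For every integer j, the identity
Σ_{k=|j|}^{∞} q^{k+1}·((q)_{k+j}·(q)_{k−j})⁻¹
  = q·((q)_∞)⁻² · Σ_{k=0}^{∞} (−1)^k·q^{j(2k+1) + k(k+1)/2}
holds in ℚ((q)), both families being summable.
-/

noncomputable section

/-- The Laurent series variable `q` of `ℚ((q))`. -/
def qq : LaurentSeries ℚ := HahnSeries.single 1 1

/-- `(q)_m = ∏_{i=1}^{m}(1−qⁱ)` in `ℚ((q))`. -/
def qPoch (m : ℕ) : LaurentSeries ℚ := ∏ i ∈ Finset.range m, (1 - qq ^ (i + 1))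

/-- `(q)_∞ = ∏_{i≥1}(1−qⁱ)` in `ℚ((q))`. -/
def qInf : LaurentSeries ℚ := ∏' i : ℕ, (1 - qq ^ (i + 1))

open Filter Topology WithZero

abbrev KK := LaurentSeries ℚ
abbrev vv : Valuation KK (WithZero (Multiplicative ℤ)) := Valued.v

lemma tz {ι : Type*} {l : Filter ι} {f : ι → KK}
    (h : ∀ d : ℕ, ∀ᶠ x in l, vv (f x) ≤ exp (-(d:ℤ))) : Tendsto f l (𝓝 0) := by
  rw [(Valued.hasBasis_nhds_zero KK (WithZero (Multiplicative ℤ))).tendsto_right_iff]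
  intro γ _
  have hne : (MonoidWithZeroHom.ValueGroup₀.embedding γ.1 : WithZero (Multiplicative ℤ)) ≠ 0 := by
    simp
  obtain ⟨e, he⟩ : ∃ e : ℤ, (MonoidWithZeroHom.ValueGroup₀.embedding γ.1 : WithZero (Multiplicative ℤ)) = exp e :=
    ⟨_, (exp_log hne).symm⟩
  filter_upwards [h (e.natAbs + 1)] with x hx
  rw [Valuation.restrict_lt_iff_lt_embedding, he]
  refine lt_of_le_of_lt hx ?_
  rw [exp_lt_exp]; omega

lemma vq (n : ℤ) : vv (qq ^ n) = exp (-n) := by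
  have : vv qq = exp (-1) := LaurentSeries.valuation_single_zpow ℚ 1
  rw [map_zpow₀, this, ← exp_zsmul]; simp

lemma vqn (n : ℕ) : vv (qq ^ n) = exp (-(n:ℤ)) := by
  rw [← zpow_natCast, vq]

lemma qq_ne : qq ≠ 0 := by
  intro h
  have := vq 1
  rw [h, zpow_one, map_zero] at this
  exact exp_ne_zero this.symm

lemma v_fac (i : ℕ) : vv (1 - qq ^ (i+1)) = 1 := by
  rw [Valuation.map_sub_eq_of_lt_left] <;> simp only [map_one]
  rw [vqn, ← exp_zero, exp_lt_exp]; omega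

lemma v_poch (m : ℕ) : vv (qPoch m) = 1 := by
  unfold qPoch
  rw [map_prod]
  exact Finset.prod_eq_one fun i _ => v_fac i

lemma poch_ne (m : ℕ) : qPoch m ≠ 0 := by
  intro h; have := v_poch m; rw [h] at this; simp at this

lemma summ {ι : Type*} {f : ι → KK}
    (h : ∀ d : ℕ, ∀ᶠ x in cofinite, vv (f x) ≤ exp (-(d:ℤ))) : Summable f := by
  have : NonarchimedeanAddGroup KK := by
    constructor
    intro U hU
    obtain ⟨γ, hγ⟩ := Valued.mem_nhds_zero.mp hU
    exact ⟨⟨Valuation.ltAddSubgroup Valued.v.restrict γ, Valued.isOpen_ball KK _⟩, hγ⟩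
  exact NonarchimedeanAddGroup.summable_of_tendsto_cofinite_zero (tz h)

lemma mult : Multipliable (fun i : ℕ => (1 - qq ^ (i + 1))) := by
  simp only [sub_eq_add_neg]
  apply multipliable_one_add_of_summable_prod
  apply summ
  intro d
  rw [Filter.eventually_cofinite]
  apply (Finset.finite_toSet ((Finset.range d).powerset)).subset
  intro s hs
  simp only [Set.mem_ofPred_eq, not_le] at hs
  simp only [Finset.coe_powerset, Set.mem_preimage, Set.mem_powerset_iff, Finset.coe_subset]
  intro i hi
  rw [Finset.mem_range]
  by_contra hd
  apply not_le_of_gt hs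
  rw [map_prod, ← Finset.mul_prod_erase _ _ hi]
  have h1 : vv (-qq ^ (i+1)) ≤ exp (-(d:ℤ)) := by
    rw [Valuation.map_neg, vqn, exp_le_exp]; omega
  have h2 : ∏ x ∈ s.erase i, vv (-qq ^ (x+1)) ≤ 1 := by
    apply Finset.prod_le_one'
    intro x _
    rw [Valuation.map_neg, vqn, ← exp_zero, exp_le_exp]; omega
  calc _ ≤ exp (-(d:ℤ)) * 1 := mul_le_mul' h1 h2
    _ = _ := mul_one _

lemma tendsto_poch : Tendsto qPoch atTop (𝓝 qInf) := mult.hasProd.tendsto_prod_nat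

lemma v_inf : vv qInf = 1 := by
  have hc : IsClosed {x : KK | vv x = 1} := by
    simpa using Valued.isClosed_sphere KK (Γ₀ := WithZero (Multiplicative ℤ)) 1
  exact hc.mem_of_tendsto tendsto_poch (Eventually.of_forall v_poch)

lemma inf_ne : qInf ≠ 0 := by
  intro h; have := v_inf; rw [h] at this; simp at this

def gg (m : ℤ) : KK := if m < 0 then 0 else (qPoch m.toNat)⁻¹

lemma gg_rec (m : ℤ) : gg m = gg (m+1) * (1 - qq ^ (m+1)) := by
  unfold gg
  rcases lt_trichotomy m (-1) with h | h | h
  · rw [if_pos (by omega), if_pos (by omega), zero_mul]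
  · subst h; simp
  · rw [if_neg (by omega), if_neg (by omega)]
    lift m to ℕ using by omega
    have : ((m:ℤ)+1).toNat = m + 1 := by omega
    have h2 := poch_ne (m+1)
    have h3 := poch_ne m
    have h4 : qq ^ ((m:ℤ)+1) = qq ^ (m+1) := by
      rw [← zpow_natCast]; push_cast; rfl
    rw [this, Int.toNat_natCast, h4]
    have h5 : qPoch (m+1) = qPoch m * (1 - qq^(m+1)) := Finset.prod_range_succ _ _
    rw [eq_comm, inv_mul_eq_iff_eq_mul₀ h2, h5]
    field_simp

lemma v_gg (m : ℤ) : vv (gg m) ≤ 1 := by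
  unfold gg
  split_ifs
  · simp
  · rw [map_inv₀, v_poch]; simp

lemma tendsto_gg (m : ℤ) : Tendsto (fun n : ℕ => gg (n + m)) atTop (𝓝 qInf⁻¹) := by
  have h1 : Tendsto (fun n : ℕ => ((n:ℤ) + m).toNat) atTop atTop := by
    rw [tendsto_atTop]
    intro b
    filter_upwards [eventually_ge_atTop (b + m.natAbs)] with n hn
    omega
  refine ((tendsto_poch.comp h1).inv₀ inf_ne).congr' ?_
  filter_upwards [eventually_ge_atTop (m.natAbs)] with n hn
  simp only [gg, Function.comp]
  rw [if_neg (by omega)]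

def aa (m : ℤ) (n : ℕ) : KK := qq ^ n * (gg n * gg (n + m))

lemma v_aa (m : ℤ) (n : ℕ) : vv (aa m n) ≤ exp (-(n:ℤ)) := by
  unfold aa
  rw [map_mul, map_mul, vqn]
  calc _ ≤ exp (-(n:ℤ)) * (1 * 1) := by
        gcongr
        · exact v_gg _
        · exact v_gg _
    _ = _ := by simp

lemma summ_aa (m : ℤ) : Summable (aa m) := by
  apply summ
  intro d
  rw [Nat.cofinite_eq_atTop]
  filter_upwards [eventually_ge_atTop d] with n hn
  refine (v_aa m n).trans ?_
  rw [exp_le_exp]; omega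

def tt (m : ℤ) (k : ℕ) : KK := (-1) ^ k * qq ^ (m * k + (k:ℤ) * ((k:ℤ)+1) / 2)

lemma v_tt (m : ℤ) (k : ℕ) : vv (tt m k) = exp (-(m * k + (k:ℤ) * ((k:ℤ)+1) / 2)) := by
  unfold tt
  rw [map_mul, map_pow, Valuation.map_neg, vq]; simp

lemma two_tri (k : ℕ) : 2 * ((k:ℤ) * ((k:ℤ)+1) / 2) = k * (k+1) :=
  Int.mul_ediv_cancel' (Int.even_mul_succ_self k).two_dvd

lemma summ_tt (m : ℤ) : Summable (tt m) := by
  apply summ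
  intro d
  rw [Nat.cofinite_eq_atTop]
  filter_upwards [eventually_ge_atTop (2 * d + 2 * m.natAbs)] with k hk
  rw [v_tt, exp_le_exp, neg_le_neg_iff]
  have := two_tri k
  have h1 : (k:ℤ) * (k + 1 + 2 * m) ≥ k * 1 := by
    apply mul_le_mul_of_nonneg_left <;> omega
  have h2 : (d:ℤ) * 2 ≤ k := by omega
  nlinarith

lemma tt_succ (m : ℤ) (k : ℕ) : tt m (k+1) = -qq^(m+1) * tt (m+1) k := by
  unfold tt
  have h : (m * (k+1:ℕ) + ((k+1:ℕ):ℤ) * (((k+1:ℕ):ℤ)+1) / 2) =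
      (m + 1) + ((m+1) * k + (k:ℤ) * ((k:ℤ)+1) / 2) := by
    have h1 := two_tri k
    have h2 := two_tri (k+1)
    push_cast at *
    linarith
  rw [h, zpow_add₀ qq_ne]
  ring

def AA (m : ℤ) : KK := ∑' n, aa m n
def TT (m : ℤ) : KK := ∑' n, tt m n

lemma TT_rec (m : ℤ) : TT m = 1 - qq^(m+1) * TT (m+1) := by
  unfold TT
  rw [(summ_tt m).tsum_eq_zero_add]
  simp only [tt_succ]
  rw [tsum_mul_left]
  simp [tt]; ring

lemma AA_rec (m : ℤ) : AA m = (qInf^2)⁻¹ - qq^(m+1) * AA (m+1) := by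
  rw [eq_sub_iff_add_eq]
  have hs := (summ_aa m).hasSum.add ((summ_aa (m+1)).hasSum.mul_left (qq^(m+1)))
  have h1 := hs.tendsto_sum_nat
  refine tendsto_nhds_unique h1 ?_
  have h2 : Tendsto (fun n : ℕ => gg (n + (-1)) * gg (n + m)) atTop (𝓝 (qInf^2)⁻¹) := by
    have := (tendsto_gg (-1)).mul (tendsto_gg m)
    convert this using 2
    rw [sq, mul_inv]
  refine h2.congr ?_
  intro N
  induction N with
  | zero => simp [gg]
  | succ N ih =>
    rw [Finset.sum_range_succ, ← ih]
    unfold aa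
    have e1 := gg_rec ((N:ℤ) + -1)
    have e2 := gg_rec ((N:ℤ) + m)
    have e3 : ((N:ℤ) + -1) + 1 = N := by ring
    have e4 : ((N+1 : ℕ):ℤ) + -1 = N := by push_cast; ring
    have e5 : ((N+1 : ℕ):ℤ) + m = N + m + 1 := by push_cast; ring
    have e6 : (N:ℤ) + (m + 1) = N + m + 1 := by ring
    rw [e3] at e1
    rw [e4, e5, e6, e1, e2]
    have e7 : qq ^ ((N:ℤ) + m + 1) = qq ^ N * qq ^ (m+1) := by
      rw [add_assoc, zpow_add₀ qq_ne, zpow_natCast]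
    rw [e7, zpow_natCast]
    ring

lemma v_tsum {f : ℕ → KK} (hf : Summable f) (h : ∀ n, vv (f n) ≤ 1) : vv (∑' n, f n) ≤ 1 := by
  have hc : IsClosed {x : KK | vv x ≤ 1} := Valued.isClosed_integer KK
  refine hc.mem_of_tendsto hf.hasSum (Eventually.of_forall fun s => ?_)
  exact vv.map_sum_le fun i _ => h i

def DD (m : ℤ) : KK := AA m - (qInf^2)⁻¹ * TT m

lemma DD_rec (m : ℤ) : DD m = - qq^(m+1) * DD (m+1) := by
  unfold DD
  rw [AA_rec, TT_rec]; ring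

lemma v_DD (N : ℕ) : ∀ m : ℤ, 0 ≤ m → vv (DD m) ≤ exp (-(N:ℤ)) := by
  induction N with
  | zero =>
    intro m hm
    simp only [Nat.cast_zero, neg_zero, exp_zero]
    refine (vv.map_sub _ _).trans (max_le ?_ ?_)
    · refine v_tsum (summ_aa m) fun n => (v_aa m n).trans ?_
      rw [← exp_zero, exp_le_exp]; omega
    · rw [map_mul, map_inv₀, map_pow, v_inf]
      simp only [one_pow, inv_one, one_mul]
      refine v_tsum (summ_tt m) fun n => ?_
      rw [v_tt, ← exp_zero, exp_le_exp]
      have : 0 ≤ (n:ℤ) * (n+1) / 2 := by positivity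
      have : 0 ≤ m * n := by positivity
      omega
  | succ N ih =>
    intro m hm
    rw [DD_rec, map_mul, Valuation.map_neg, vq]
    calc _ ≤ exp (-(m+1)) * exp (-(N:ℤ)) := by gcongr; exact ih _ (by omega)
      _ ≤ _ := by rw [← exp_add, exp_le_exp]; push_cast; omega

lemma DD_nonneg (m : ℤ) (hm : 0 ≤ m) : DD m = 0 := by
  rw [← vv.zero_iff]
  by_contra h
  have h1 := v_DD ((log (vv (DD m))).natAbs + 1) m hm
  rw [← exp_log h] at h1
  rw [exp_le_exp] at h1
  simp only [log_exp] at h1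
  omega

lemma DD_zero (m : ℤ) : DD m = 0 := by
  have : ∀ n : ℕ, DD (-n) = 0 := by
    intro n
    induction n with
    | zero => exact DD_nonneg _ (by simp)
    | succ n ih =>
      rw [DD_rec]
      have : -((n+1:ℕ):ℤ) + 1 = -n := by push_cast; ring
      rw [this, ih, mul_zero]
  rcases le_total 0 m with h | h
  · exact DD_nonneg m h
  · have := this m.natAbs
    rwa [show -(m.natAbs:ℤ) = m by omega] at this

lemma AA_eq (m : ℤ) : AA m = (qInf^2)⁻¹ * TT m := sub_eq_zero.mp (DD_zero m)

lemma hasSum_aa (m : ℤ) : HasSum (aa m) ((qInf^2)⁻¹ * TT m) := by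
  rw [← AA_eq]; exact (summ_aa m).hasSum

lemma lhs (j : ℤ) : HasSum (fun k : ℕ => qq ^ (k+1) * (gg (k + j) * gg (k - j)))
    (qq * (qInf^2)⁻¹ * (qq ^ j * TT (2*j))) := by
  have h := (hasSum_aa (2*j)).mul_left (qq ^ (j+1))
  have e : qq ^ (j+1) * ((qInf^2)⁻¹ * TT (2*j)) = qq * (qInf^2)⁻¹ * (qq ^ j * TT (2*j)) := by
    rw [zpow_add_one₀ qq_ne]; ring
  rw [e] at h
  have key : ∀ n k : ℕ, (k:ℤ) = n + j → 
      qq ^ (j+1) * aa (2*j) n = qq ^ (k+1) * (gg (k + j) * gg (k - j)) := by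
    intro n k hk
    unfold aa
    rw [hk, ← zpow_natCast, ← zpow_natCast]
    push_cast
    rw [hk, ← mul_assoc, ← zpow_add₀ qq_ne]
    ring_nf
  rcases le_total 0 j with hj | hj
  · lift j to ℕ using hj
    have h2 := (hasSum_nat_add_iff (f := fun k : ℕ => qq ^ (k+1) * (gg (k + j) * gg (k - j))) 
      (g := qq * (qInf^2)⁻¹ * (qq ^ (j:ℤ) * TT (2*j))) j).mp (by
        have hf := funext fun n : ℕ => key n (n+j) (by push_cast; ring)
        rw [hf] at h
        exact h)
    rwa [Finset.sum_eq_zero, add_zero] at h2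
    intro i hi
    rw [Finset.mem_range] at hi
    simp only [gg]
    rw [if_pos (show (i:ℤ) - j < 0 by omega)]
    simp
  · obtain ⟨J, rfl⟩ : ∃ J : ℕ, j = -J := ⟨j.natAbs, by omega⟩
    have h2 := (hasSum_nat_add_iff (f := fun n : ℕ => qq ^ (-(J:ℤ)+1) * aa (2*(-J)) n) 
      (g := qq * (qInf^2)⁻¹ * (qq ^ (-(J:ℤ)) * TT (2*(-J)))) J).mpr (by
        rw [Finset.sum_eq_zero, add_zero]
        · exact h
        intro i hi
        rw [Finset.mem_range] at hi
        simp only [aa, gg]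
        rw [if_pos (show (i:ℤ) + 2 * (-J) < 0 by omega)]
        simp)
    have hf := funext fun n : ℕ => key (n+J) n (by push_cast; ring)
    rw [hf] at h2
    exact h2

theorem trefoil_residues (j : ℤ) :
    Summable (fun k : ℕ => if (k : ℤ) < |j| then 0 else
      qq ^ (k + 1) * (qPoch ((k : ℤ) + j).toNat * qPoch ((k : ℤ) - j).toNat)⁻¹) ∧
    Summable (fun k : ℕ =>
      (-1 : LaurentSeries ℚ) ^ k * qq ^ (j * (2 * (k : ℤ) + 1) + (k : ℤ) * ((k : ℤ) + 1) / 2)) ∧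
    (∑' k : ℕ, if (k : ℤ) < |j| then 0 else
        qq ^ (k + 1) * (qPoch ((k : ℤ) + j).toNat * qPoch ((k : ℤ) - j).toNat)⁻¹)
      = qq * (qInf ^ 2)⁻¹ *
        ∑' k : ℕ,
          (-1 : LaurentSeries ℚ) ^ k *
            qq ^ (j * (2 * (k : ℤ) + 1) + (k : ℤ) * ((k : ℤ) + 1) / 2) := by
  have e1 : (fun k : ℕ => if (k : ℤ) < |j| then (0 : LaurentSeries ℚ) else
      qq ^ (k + 1) * (qPoch ((k : ℤ) + j).toNat * qPoch ((k : ℤ) - j).toNat)⁻¹) =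
      (fun k : ℕ => qq ^ (k+1) * (gg (k + j) * gg (k - j))) := by
    funext k
    unfold gg
    split_ifs with h1 h2 h3 h4 h5 <;> first | (exfalso; grind) | (rw [mul_inv]) | simp
  have e2 : (fun k : ℕ =>
      (-1 : LaurentSeries ℚ) ^ k * qq ^ (j * (2 * (k : ℤ) + 1) + (k : ℤ) * ((k : ℤ) + 1) / 2)) =
      (fun k : ℕ => qq ^ j * tt (2*j) k) := by
    funext k
    unfold tt
    rw [mul_left_comm, ← zpow_add₀ qq_ne]
    congr 2
    ring
  have hl := lhs j
  have hr := (summ_tt (2*j)).hasSum.mul_left (qq ^ j)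
  rw [e1, e2]
  exact ⟨hl.summable, hr.summable, by rw [hl.tsum_eq, hr.tsum_eq]; rfl⟩
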